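/- arXiv:math/0509558 — 2 statements merged into one kernel-verified Lean document; each statement's English description precedes it below -/
import Mathlib

section
/- Let ψ(u) = u^γ with γ ∈ (1,2]. For p ≥ 1 and a tree T ∈ T*_p (rooted ordered tree with p leaves, all internal vertices having ≥ 2 children), define w(T) = (p! / ∏_{v∈N_T} k_v!) · (∏_{v∈N_T} |(γ-1)(γ-2)···(γ-k_v+1)|) / ((γ-1)(2γ-1)···((p-1)γ-1)). Then Σ_{T ∈ T*_p} w(T) = 1. -/
def IsRootedOrderedTree (T : Finset (List ℕ)) : Prop :=
  [] ∈ T ∧ (∀ (u : List ℕ) (j : ℕ), u ++ [j] ∈ T → u ∈ T) ∧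
    ∀ u ∈ T, ∃ k : ℕ, ∀ j : ℕ, u ++ [j] ∈ T ↔ 1 ≤ j ∧ j ≤ k

def numChildren (T : Finset (List ℕ)) (u : List ℕ) : ℕ :=
  (T.filter (fun v => u <+: v ∧ v.length = u.length + 1)).card

def leaves (T : Finset (List ℕ)) : Finset (List ℕ) :=
  T.filter (fun u => numChildren T u = 0)

def internalVertices (T : Finset (List ℕ)) : Finset (List ℕ) :=
  T.filter (fun u => numChildren T u ≠ 0)

/-! ### Grafting trees on a common root -/

/-- The tree whose root has the subtrees `f 0, …, f (k - 1)`, in this order. -/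
def graft {k : ℕ} (f : Fin k → Finset (List ℕ)) : Finset (List ℕ) :=
  insert [] (Finset.univ.biUnion fun i : Fin k => (f i).image (List.cons ((i : ℕ) + 1)))

/-- Every internal vertex of the rooted ordered tree has at least two children. -/
def IsReducedTree (T : Finset (List ℕ)) : Prop :=
  IsRootedOrderedTree T ∧ ∀ v ∈ internalVertices T, 2 ≤ numChildren T v

section Graft

variable {k : ℕ} {f : Fin k → Finset (List ℕ)}

lemma nil_mem_graft : [] ∈ graft f := by simp [graft]

lemma cons_mem_graft {m : ℕ} {u : List ℕ} :
    m :: u ∈ graft f ↔ ∃ i : Fin k, (i : ℕ) + 1 = m ∧ u ∈ f i := by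
  simp only [graft, Finset.mem_insert, Finset.mem_biUnion, Finset.mem_image, Finset.mem_univ,
    true_and, List.cons.injEq, reduceCtorEq, false_or]
  constructor
  · rintro ⟨i, a, ha, rfl, rfl⟩
    exact ⟨i, rfl, ha⟩
  · rintro ⟨i, rfl, hu⟩
    exact ⟨i, u, hu, rfl, rfl⟩

lemma succ_cons_mem_graft {i : Fin k} {u : List ℕ} : ((i : ℕ) + 1) :: u ∈ graft f ↔ u ∈ f i := by
  rw [cons_mem_graft]
  constructor
  · rintro ⟨j, hj, hu⟩
    obtain rfl : j = i := Fin.ext (by omega)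
    exact hu
  · exact fun hu => ⟨i, rfl, hu⟩

lemma graft_injective : Function.Injective (graft (k := k)) := by
  intro f g h
  ext i u
  rw [← succ_cons_mem_graft (f := f), h, succ_cons_mem_graft]

@[to_additive]
lemma prod_graft {M : Type*} [CommMonoid M] (g : List ℕ → M) :
    ∏ v ∈ graft f, g v = g [] * ∏ i : Fin k, ∏ u ∈ f i, g (((i : ℕ) + 1) :: u) := by
  rw [graft, Finset.prod_insert (by simp), Finset.prod_biUnion]
  · congr 1
    refine Finset.prod_congr rfl fun i _ => Finset.prod_image ?_
    intro u _ v _ h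
    simpa using h
  · intro i _ j _ hij
    refine Finset.disjoint_left.2 fun v hv hv' => hij ?_
    simp only [Finset.mem_image] at hv hv'
    obtain ⟨a, -, rfl⟩ := hv
    obtain ⟨b, -, hb⟩ := hv'
    simp only [List.cons.injEq] at hb
    exact Fin.ext (by omega)

lemma numChildren_graft_nil (hf : ∀ i, [] ∈ f i) : numChildren (graft f) [] = k := by
  have h : (graft f).filter (fun v => [] <+: v ∧ v.length = ([] : List ℕ).length + 1) =
      Finset.univ.image fun i : Fin k => [(i : ℕ) + 1] := by
    ext v
    rcases v with - | ⟨m, u⟩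
    · simp
    · simp only [Finset.mem_filter, cons_mem_graft, List.nil_prefix, List.length_cons,
        List.length_nil, true_and, Finset.mem_image, Finset.mem_univ, List.cons.injEq]
      constructor
      · rintro ⟨⟨i, hi, -⟩, hu⟩
        exact ⟨i, hi, (List.length_eq_zero_iff.1 (by omega)).symm⟩
      · rintro ⟨i, hi, rfl⟩
        exact ⟨⟨i, hi, hf i⟩, by simp⟩
  rw [numChildren, h, Finset.card_image_of_injective, Finset.card_univ, Fintype.card_fin]
  intro i j hij
  simpa [Fin.ext_iff] using hij

lemma numChildren_graft_cons (i : Fin k) (u : List ℕ) :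
    numChildren (graft f) (((i : ℕ) + 1) :: u) = numChildren (f i) u := by
  have h : (graft f).filter
      (fun v => ((i : ℕ) + 1) :: u <+: v ∧ v.length = (((i : ℕ) + 1) :: u).length + 1) =
      ((f i).filter fun v => u <+: v ∧ v.length = u.length + 1).image
        (List.cons ((i : ℕ) + 1)) := by
    ext v
    rcases v with - | ⟨m, w⟩
    · simp
    · simp only [Finset.mem_filter, List.cons_prefix_cons, List.length_cons, Finset.mem_image,
        List.cons.injEq]
      constructor
      · rintro ⟨hw, ⟨rfl, hp⟩, hl⟩
        exact ⟨w, ⟨succ_cons_mem_graft.1 hw, hp, by omega⟩, rfl, rfl⟩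
      · rintro ⟨w', ⟨hw, hp, hl⟩, rfl, rfl⟩
        exact ⟨succ_cons_mem_graft.2 hw, ⟨rfl, hp⟩, by omega⟩
  rw [numChildren, h, Finset.card_image_of_injective _ (List.cons_injective), numChildren]

lemma card_leaves_eq_sum (T : Finset (List ℕ)) :
    (leaves T).card = ∑ v ∈ T, if numChildren T v = 0 then 1 else 0 := by
  rw [leaves, Finset.card_filter]

lemma card_leaves_graft (hf : ∀ i, [] ∈ f i) :
    (leaves (graft f)).card = (if k = 0 then 1 else 0) + ∑ i, (leaves (f i)).card := by
  simp only [card_leaves_eq_sum, sum_graft, numChildren_graft_nil hf, numChildren_graft_cons]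

lemma isRootedOrderedTree_graft (hf : ∀ i, IsRootedOrderedTree (f i)) :
    IsRootedOrderedTree (graft f) := by
  refine ⟨nil_mem_graft, ?_, ?_⟩
  · intro u j h
    rcases u with - | ⟨m, u⟩
    · exact nil_mem_graft
    · rw [List.cons_append, cons_mem_graft] at h
      obtain ⟨i, rfl, hu⟩ := h
      exact succ_cons_mem_graft.2 ((hf i).2.1 u j hu)
  · intro u hu
    rcases u with - | ⟨m, u⟩
    · refine ⟨k, fun j => ?_⟩
      rw [List.nil_append, cons_mem_graft]
      constructor
      · rintro ⟨i, rfl, -⟩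
        exact ⟨by omega, i.2⟩
      · rintro ⟨h1, h2⟩
        exact ⟨⟨j - 1, by omega⟩, by simp only; omega, (hf _).1⟩
    · obtain ⟨i, rfl, hui⟩ := cons_mem_graft.1 hu
      obtain ⟨n, hn⟩ := (hf i).2.2 u hui
      exact ⟨n, fun j => by rw [List.cons_append, succ_cons_mem_graft, hn]⟩

lemma isReducedTree_iff {T : Finset (List ℕ)} :
    IsReducedTree T ↔ IsRootedOrderedTree T ∧ ∀ v ∈ T, numChildren T v ≠ 1 := by
  refine and_congr_right fun _ => ?_
  simp only [internalVertices, Finset.mem_filter, and_imp]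
  refine forall₂_congr fun v _ => ?_
  omega

lemma isReducedTree_graft (hk : k ≠ 1) (hf : ∀ i, IsReducedTree (f i)) :
    IsReducedTree (graft f) := by
  refine isReducedTree_iff.2 ⟨isRootedOrderedTree_graft fun i => (hf i).1, fun v hv => ?_⟩
  rcases v with - | ⟨m, u⟩
  · rwa [numChildren_graft_nil fun i => (hf i).1.1]
  · obtain ⟨i, rfl, hu⟩ := cons_mem_graft.1 hv
    rw [numChildren_graft_cons]
    exact (isReducedTree_iff.1 (hf i)).2 u hu

end Graft

lemma IsRootedOrderedTree.singleton_mem {T : Finset (List ℕ)} (hT : IsRootedOrderedTree T)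
    {m : ℕ} {u : List ℕ} (h : m :: u ∈ T) : [m] ∈ T := by
  induction u using List.reverseRecOn with
  | nil => exact h
  | append_singleton u j ih => exact ih (hT.2.1 (m :: u) j (by simpa using h))

lemma IsRootedOrderedTree.exists_eq_graft {T : Finset (List ℕ)} (hT : IsRootedOrderedTree T) :
    ∃ (k : ℕ) (f : Fin k → Finset (List ℕ)), (∀ i, IsRootedOrderedTree (f i)) ∧ graft f = T := by
  obtain ⟨k, hk⟩ := hT.2.2 [] hT.1
  simp only [List.nil_append] at hk
  let f : Fin k → Finset (List ℕ) := fun i =>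
    T.preimage (List.cons ((i : ℕ) + 1)) List.cons_injective.injOn
  have hf : ∀ i u, u ∈ f i ↔ ((i : ℕ) + 1) :: u ∈ T := fun i u => Finset.mem_preimage
  refine ⟨k, f, fun i => ⟨?_, fun u j h => ?_, fun u hu => ?_⟩, ?_⟩
  · exact (hf _ _).2 ((hk _).2 ⟨by omega, i.2⟩)
  · rw [hf] at h ⊢
    exact hT.2.1 _ j h
  · obtain ⟨n, hn⟩ := hT.2.2 _ ((hf _ _).1 hu)
    exact ⟨n, fun j => by rw [hf, ← hn, List.cons_append]⟩
  · ext v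
    rcases v with - | ⟨m, u⟩
    · simp [nil_mem_graft, hT.1]
    · rw [cons_mem_graft]
      constructor
      · rintro ⟨i, rfl, hu⟩
        exact (hf _ _).1 hu
      · intro h
        obtain ⟨h1, h2⟩ := (hk m).1 (hT.singleton_mem h)
        obtain ⟨m, rfl⟩ : ∃ n, m = n + 1 := ⟨m - 1, by omega⟩
        exact ⟨⟨m, h2⟩, rfl, (hf _ _).2 h⟩

lemma IsReducedTree.exists_eq_graft {T : Finset (List ℕ)} (hT : IsReducedTree T) :
    ∃ (k : ℕ) (f : Fin k → Finset (List ℕ)),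
      k ≠ 1 ∧ (∀ i, IsReducedTree (f i)) ∧ graft f = T := by
  obtain ⟨k, f, hf, rfl⟩ := IsRootedOrderedTree.exists_eq_graft hT.1
  have h := (isReducedTree_iff.1 hT).2
  refine ⟨k, f, ?_, fun i => isReducedTree_iff.2 ⟨hf i, fun u hu => ?_⟩, rfl⟩
  · simpa [numChildren_graft_nil fun i => (hf i).1] using h [] nil_mem_graft
  · simpa [numChildren_graft_cons] using h _ (succ_cons_mem_graft.2 hu)

lemma card_leaves_pos {T : Finset (List ℕ)} (hT : T.Nonempty) : 0 < (leaves T).card := by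
  obtain ⟨v, hv, hmax⟩ := T.exists_max_image List.length hT
  refine Finset.card_pos.2 ⟨v, Finset.mem_filter.2 ⟨hv, ?_⟩⟩
  refine Finset.card_eq_zero.2 (Finset.filter_eq_empty_iff.2 fun w hw h => ?_)
  have := hmax w hw
  omega

lemma IsReducedTree.card_leaves_pos {T : Finset (List ℕ)} (hT : IsReducedTree T) :
    0 < (leaves T).card :=
  _root_.card_leaves_pos ⟨[], hT.1.1⟩

lemma le_sum_card_leaves {k : ℕ} {f : Fin k → Finset (List ℕ)} (hf : ∀ i, IsReducedTree (f i)) :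
    k ≤ ∑ i, (leaves (f i)).card := by
  simpa using Finset.card_nsmul_le_sum Finset.univ (fun i => (leaves (f i)).card) 1
    fun i _ => (hf i).card_leaves_pos

lemma card_leaves_lt_sum {k : ℕ} {f : Fin k → Finset (List ℕ)} (hk : 2 ≤ k)
    (hf : ∀ i, IsReducedTree (f i)) (i : Fin k) :
    (leaves (f i)).card < ∑ j, (leaves (f j)).card := by
  have : Nontrivial (Fin k) := Fin.nontrivial_iff_two_le.2 hk
  obtain ⟨j, hj⟩ := exists_ne i
  exact Finset.single_lt_sum (f := fun i => (leaves (f i)).card) hj (Finset.mem_univ i)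
    (Finset.mem_univ j) (hf j).card_leaves_pos
    fun _ _ _ => Nat.zero_le _

lemma card_leaves_graft_of_two_le {k : ℕ} {f : Fin k → Finset (List ℕ)} (hk : 2 ≤ k)
    (hf : ∀ i, IsReducedTree (f i)) :
    (leaves (graft f)).card = ∑ i, (leaves (f i)).card := by
  rw [card_leaves_graft fun i => (hf i).1.1, if_neg (by omega), zero_add]

lemma graft_fin_zero (f : Fin 0 → Finset (List ℕ)) : graft f = {[]} := by
  simp [graft]

lemma isReducedTree_singleton_nil : IsReducedTree {[]} := by
  rw [← graft_fin_zero Fin.elim0]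
  exact isReducedTree_graft zero_ne_one fun i => i.elim0

lemma numChildren_singleton_nil : numChildren {[]} [] = 0 := by
  simp [numChildren]

lemma card_leaves_singleton_nil : (leaves {[]}).card = 1 := by
  rw [card_leaves_eq_sum, Finset.sum_singleton, numChildren_singleton_nil, if_pos rfl]

lemma IsReducedTree.eq_singleton_or_graft {T : Finset (List ℕ)} (hT : IsReducedTree T) :
    T = {[]} ∨ ∃ (k : ℕ) (f : Fin k → Finset (List ℕ)),
      2 ≤ k ∧ (∀ i, IsReducedTree (f i)) ∧ graft f = T := by
  obtain ⟨k, f, hk, hf, rfl⟩ := hT.exists_eq_graft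
  rcases Nat.eq_zero_or_pos k with rfl | hk0
  · exact .inl (graft_fin_zero f)
  · exact .inr ⟨k, f, by omega, hf, rfl⟩

lemma finite_isReducedTree_card_leaves_le (N : ℕ) :
    {T | IsReducedTree T ∧ (leaves T).card ≤ N}.Finite := by
  induction N with
  | zero =>
    refine Set.Finite.subset Set.finite_empty fun T hT => ?_
    have := hT.1.card_leaves_pos
    have := hT.2
    omega
  | succ N ih =>
    refine Set.Finite.subset (s := insert {[]} (⋃ k ∈ Set.Iic (N + 1), graft (k := k) ''
      Set.univ.pi fun _ => {T | IsReducedTree T ∧ (leaves T).card ≤ N})) ?_ ?_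
    · exact ((Set.finite_Iic _).biUnion fun k _ => (Set.Finite.pi fun _ => ih).image _).insert _
    · rintro T ⟨hT, hN⟩
      rcases hT.eq_singleton_or_graft with rfl | ⟨k, f, hk, hf, rfl⟩
      · exact .inl rfl
      · rw [card_leaves_graft_of_two_le hk hf] at hN
        refine .inr (Set.mem_biUnion (x := k) ((le_sum_card_leaves hf).trans hN) ⟨f, ?_, rfl⟩)
        intro i _
        exact ⟨hf i, by have := card_leaves_lt_sum hk hf i; omega⟩

/-- The reduced trees with at most `N` leaves. -/
noncomputable def reducedTreesLE (N : ℕ) : Finset (Finset (List ℕ)) :=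
  (finite_isReducedTree_card_leaves_le N).toFinset

lemma mem_reducedTreesLE {N : ℕ} {T : Finset (List ℕ)} :
    T ∈ reducedTreesLE N ↔ IsReducedTree T ∧ (leaves T).card ≤ N := by
  simp [reducedTreesLE]

/-- The reduced trees with exactly `n` leaves. -/
noncomputable def reducedTrees (n : ℕ) : Finset (Finset (List ℕ)) :=
  (reducedTreesLE n).filter fun T => (leaves T).card = n

lemma mem_reducedTrees {n : ℕ} {T : Finset (List ℕ)} :
    T ∈ reducedTrees n ↔ IsReducedTree T ∧ (leaves T).card = n := by
  simp only [reducedTrees, Finset.mem_filter, mem_reducedTreesLE]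
  constructor
  · exact fun h => ⟨h.1.1, h.2⟩
  · exact fun h => ⟨⟨h.1, h.2.le⟩, h.2⟩

lemma reducedTrees_zero : reducedTrees 0 = ∅ := by
  refine Finset.eq_empty_of_forall_notMem fun T hT => ?_
  obtain ⟨h, h0⟩ := mem_reducedTrees.1 hT
  exact h.card_leaves_pos.ne' h0

lemma reducedTrees_one : reducedTrees 1 = {{[]}} := by
  ext T
  rw [mem_reducedTrees, Finset.mem_singleton]
  constructor
  · rintro ⟨hT, h1⟩
    rcases hT.eq_singleton_or_graft with h | ⟨k, f, hk, hf, rfl⟩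
    · exact h
    · rw [card_leaves_graft_of_two_le hk hf] at h1
      have := le_sum_card_leaves hf
      omega
  · rintro rfl
    exact ⟨isReducedTree_singleton_nil, card_leaves_singleton_nil⟩

/-! ### Weighted enumeration of reduced trees -/

section Weight

variable {R : Type*} [CommRing R]

/-- The product over all vertices of a weight depending on the number of children. -/
def treeWeight (a : ℕ → R) (T : Finset (List ℕ)) : R :=
  ∏ v ∈ T, a (numChildren T v)

lemma treeWeight_graft (a : ℕ → R) {k : ℕ} {f : Fin k → Finset (List ℕ)}
    (hf : ∀ i, [] ∈ f i) : treeWeight a (graft f) = a k * ∏ i, treeWeight a (f i) := by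
  simp only [treeWeight, prod_graft, numChildren_graft_nil hf, numChildren_graft_cons]

/-- The generating polynomial of the reduced trees with at most `N` leaves. -/
noncomputable def treeSeries (a : ℕ → R) (N : ℕ) : PowerSeries R :=
  ∑ T ∈ reducedTreesLE N, PowerSeries.monomial (leaves T).card (treeWeight a T)

lemma coeff_treeSeries (a : ℕ → R) {n N : ℕ} (h : n ≤ N) :
    PowerSeries.coeff n (treeSeries a N) = ∑ T ∈ reducedTrees n, treeWeight a T := by
  have hS : reducedTrees n = (reducedTreesLE N).filter fun T => n = (leaves T).card := by
    ext T
    rw [mem_reducedTrees, Finset.mem_filter, mem_reducedTreesLE]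
    constructor
    · exact fun hT => ⟨⟨hT.1, hT.2.trans_le h⟩, hT.2.symm⟩
    · exact fun hT => ⟨hT.1.1, hT.2.symm⟩
  simp only [treeSeries, map_sum, PowerSeries.coeff_monomial, hS, Finset.sum_filter]

lemma prod_monomial {ι : Type*} (s : Finset ι) (d : ι → ℕ) (c : ι → R) :
    ∏ i ∈ s, PowerSeries.monomial (d i) (c i) =
      PowerSeries.monomial (∑ i ∈ s, d i) (∏ i ∈ s, c i) := by
  classical
  induction s using Finset.induction_on with
  | empty => simp
  | insert i s hi ih =>
    rw [Finset.prod_insert hi, Finset.sum_insert hi, Finset.prod_insert hi, ih,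
      PowerSeries.monomial_mul_monomial]

lemma coeff_treeSeries_pow (a : ℕ → R) (n N k : ℕ) :
    PowerSeries.coeff n (treeSeries a N ^ k) =
      ∑ f ∈ (Fintype.piFinset fun _ : Fin k => reducedTreesLE N).filter
        (fun f => ∑ i, (leaves (f i)).card = n), ∏ i, treeWeight a (f i) := by
  have h : treeSeries a N ^ k = ∏ _i : Fin k, treeSeries a N := by simp
  rw [h]
  simp only [treeSeries, Finset.prod_univ_sum, prod_monomial, map_sum,
    PowerSeries.coeff_monomial, Finset.sum_filter, eq_comm]

lemma sum_treeWeight_reducedTrees (a : ℕ → R) {n : ℕ} (hn : 1 ≤ n) :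
    ∑ T ∈ reducedTrees (n + 1), treeWeight a T =
      ∑ k ∈ Finset.Icc 2 (n + 1), a k * PowerSeries.coeff (n + 1) (treeSeries a n ^ k) := by
  simp only [coeff_treeSeries_pow, Finset.mul_sum]
  rw [Finset.sum_sigma']
  symm
  have key : ∀ x : Σ k : ℕ, Fin k → Finset (List ℕ),
      x ∈ (Finset.Icc 2 (n + 1)).sigma (fun k =>
        (Fintype.piFinset fun _ : Fin k => reducedTreesLE n).filter
          (fun f => ∑ i, (leaves (f i)).card = n + 1)) →
      2 ≤ x.1 ∧ (∀ i, IsReducedTree (x.2 i)) ∧ ∑ i, (leaves (x.2 i)).card = n + 1 := by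
    rintro ⟨k, f⟩ hx
    simp only [Finset.mem_sigma, Finset.mem_Icc, Finset.mem_filter, Fintype.mem_piFinset,
      mem_reducedTreesLE] at hx
    exact ⟨hx.1.1, fun i => (hx.2.1 i).1, hx.2.2⟩
  refine Finset.sum_nbij (fun x => graft x.2) ?_ ?_ ?_ ?_
  · intro x hx
    obtain ⟨hk, hf, hn⟩ := key x hx
    exact mem_reducedTrees.2
      ⟨isReducedTree_graft (by omega) hf, (card_leaves_graft_of_two_le hk hf).trans hn⟩
  · rintro ⟨k, f⟩ hx ⟨l, g⟩ hy h
    obtain ⟨-, hf, -⟩ := key _ hx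
    obtain ⟨-, hg, -⟩ := key _ hy
    have h' : graft f = graft g := h
    obtain rfl : k = l := by
      have hk := numChildren_graft_nil (f := f) fun i => (hf i).1.1
      rwa [h', numChildren_graft_nil fun i => (hg i).1.1, eq_comm] at hk
    rw [graft_injective h']
  · intro T hT
    obtain ⟨hT, hl⟩ := mem_reducedTrees.1 hT
    rcases hT.eq_singleton_or_graft with rfl | ⟨k, f, hk, hf, rfl⟩
    · rw [card_leaves_singleton_nil] at hl
      omega
    · rw [card_leaves_graft_of_two_le hk hf] at hl
      refine ⟨⟨k, f⟩, ?_, rfl⟩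
      simp only [Finset.coe_sigma, Set.mem_sigma_iff, Finset.mem_coe, Finset.mem_Icc,
        Finset.mem_filter, Fintype.mem_piFinset, mem_reducedTreesLE]
      refine ⟨⟨hk, hl ▸ le_sum_card_leaves hf⟩, fun i => ⟨hf i, ?_⟩, hl⟩
      have := card_leaves_lt_sum hk hf i
      omega
  · intro x hx
    obtain ⟨-, hf, -⟩ := key x hx
    exact (treeWeight_graft a fun i => (hf i).1.1).symm

lemma coeff_pow_congr {F G : PowerSeries R} {n k : ℕ} (hk : 2 ≤ k)
    (hF : PowerSeries.coeff 0 F = 0) (hG : PowerSeries.coeff 0 G = 0)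
    (h : ∀ m ≤ n, PowerSeries.coeff m F = PowerSeries.coeff m G) :
    PowerSeries.coeff (n + 1) (F ^ k) = PowerSeries.coeff (n + 1) (G ^ k) := by
  have hX : (PowerSeries.X : PowerSeries R) ^ (n + 1) ∣ F - G :=
    PowerSeries.X_pow_dvd_iff.2 fun m hm => by rw [map_sub, h m (by omega), sub_self]
  have hXF : PowerSeries.X ∣ F := PowerSeries.X_dvd_iff.2 (by simpa using hF)
  have hXG : PowerSeries.X ∣ G := PowerSeries.X_dvd_iff.2 (by simpa using hG)
  have hX' : PowerSeries.X ∣ ∑ i ∈ Finset.range k, F ^ i * G ^ (k - 1 - i) := by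
    refine Finset.dvd_sum fun i hi => ?_
    rcases Nat.eq_zero_or_pos i with rfl | hi0
    · exact (hXG.trans (dvd_pow_self G (by omega))).mul_left _
    · exact (hXF.trans (dvd_pow_self F (by omega))).mul_right _
  have hdvd := mul_dvd_mul hX' hX
  rw [(Commute.all F G).geom_sum₂_mul, ← pow_succ'] at hdvd
  have := PowerSeries.X_pow_dvd_iff.1 hdvd (n + 1) (by omega)
  rwa [map_sub, sub_eq_zero] at this

/-- A power series `∑ b n X ^ n` without constant term solving `G = X + ∑_{k ≥ 2} a k G ^ k`
enumerates the weighted reduced trees by their number of leaves. -/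
lemma sum_treeWeight_eq_of_recurrence {a : ℕ → R} {G : PowerSeries R} (ha : a 0 = 1)
    (hG0 : PowerSeries.coeff 0 G = 0) (hG1 : PowerSeries.coeff 1 G = 1)
    (hG : ∀ n, 2 ≤ n → PowerSeries.coeff n G =
      ∑ k ∈ Finset.Icc 2 n, a k * PowerSeries.coeff n (G ^ k)) (n : ℕ) :
    ∑ T ∈ reducedTrees n, treeWeight a T = PowerSeries.coeff n G := by
  induction n using Nat.strong_induction_on with
  | _ n ih =>
    obtain rfl | rfl | ⟨m, hm, rfl⟩ : n = 0 ∨ n = 1 ∨ ∃ m, 1 ≤ m ∧ n = m + 1 := by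
      rcases n with - | - | m
      · simp
      · simp
      · exact .inr (.inr ⟨m + 1, by omega, rfl⟩)
    · rw [reducedTrees_zero, Finset.sum_empty, hG0]
    · rw [reducedTrees_one, Finset.sum_singleton, hG1, treeWeight, Finset.prod_singleton,
        numChildren_singleton_nil, ha]
    · rw [sum_treeWeight_reducedTrees a hm, hG _ (by omega)]
      refine Finset.sum_congr rfl fun k hk => ?_
      have hc : ∀ j ≤ m, PowerSeries.coeff j (treeSeries a m) = PowerSeries.coeff j G :=
        fun j hj => by rw [coeff_treeSeries a hj, ih j (by omega)]
      rw [coeff_pow_congr (Finset.mem_Icc.1 hk).1 ((hc 0 (by omega)).trans hG0) hG0 hc]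

end Weight

/-! ### The power series `1 - (1 - γ X) ^ (1 / γ)` -/

section Stable

variable (γ : ℝ)

/-- The branching weights of the `γ`-stable tree. -/
noncomputable def stableWeight (k : ℕ) : ℝ :=
  |∏ i ∈ Finset.Ico 1 k, (γ - (i : ℝ))| / (k.factorial : ℝ)

/-- The expansion of `1 - (1 - γ X) ^ (1 / γ)`. -/
noncomputable def stableSeries : PowerSeries ℝ :=
  PowerSeries.mk fun n =>
    if n = 0 then 0 else (∏ j ∈ Finset.Ico 1 n, ((j : ℝ) * γ - 1)) / (n.factorial : ℝ)

lemma coeff_stableSeries {n : ℕ} (hn : n ≠ 0) : PowerSeries.coeff n (stableSeries γ) =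
    (∏ j ∈ Finset.Ico 1 n, ((j : ℝ) * γ - 1)) / (n.factorial : ℝ) := by
  simp [stableSeries, hn]

lemma coeff_zero_stableSeries : PowerSeries.coeff 0 (stableSeries γ) = 0 := by
  simp [stableSeries]

lemma coeff_one_stableSeries : PowerSeries.coeff 1 (stableSeries γ) = 1 := by
  simp [stableSeries]

lemma succ_mul_coeff_stableSeries {n : ℕ} (hn : n ≠ 0) :
    ((n : ℝ) + 1) * PowerSeries.coeff (n + 1) (stableSeries γ) =
      (n * γ - 1) * PowerSeries.coeff n (stableSeries γ) := by
  rw [coeff_stableSeries γ hn, coeff_stableSeries γ n.succ_ne_zero,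
    Finset.prod_Ico_succ_top (by omega), Nat.factorial_succ]
  have : (n.factorial : ℝ) ≠ 0 := by positivity
  generalize ∏ j ∈ Finset.Ico 1 n, ((j : ℝ) * γ - 1) = P
  push_cast
  field_simp

lemma coeff_one_sub_X_mul_derivative (F : PowerSeries ℝ) (n : ℕ) :
    PowerSeries.coeff n ((1 - PowerSeries.C γ * PowerSeries.X) *
      PowerSeries.derivative ℝ F) =
      ((n : ℝ) + 1) * PowerSeries.coeff (n + 1) F - γ * n * PowerSeries.coeff n F := by
  rw [sub_mul, one_mul, map_sub, mul_assoc, PowerSeries.coeff_C_mul, PowerSeries.coeff_derivative]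
  rcases n with - | n
  · simp
  · rw [PowerSeries.coeff_succ_X_mul, PowerSeries.coeff_derivative]
    push_cast
    ring

lemma derivative_stableSeries :
    (1 - PowerSeries.C γ * PowerSeries.X) * PowerSeries.derivative ℝ (stableSeries γ) =
      1 - stableSeries γ := by
  ext n
  rw [coeff_one_sub_X_mul_derivative, map_sub]
  rcases Nat.eq_zero_or_pos n with rfl | hn
  · simp [coeff_one_stableSeries, coeff_zero_stableSeries, -PowerSeries.coeff_zero_eq_constantCoeff]
  · rw [succ_mul_coeff_stableSeries γ hn.ne', PowerSeries.coeff_one, if_neg hn.ne']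
    ring

/-- For the coefficients `c` of `(1 - (1 - t) ^ γ) / γ`, the partial sums of the composition with
`stableSeries γ` solve the differential equation of `X` up to a term of high order. -/
lemma derivative_sum_stableSeries_pow {c : ℕ → ℝ} (hc0 : c 0 = 0) (hc1 : c 1 = 1)
    (hc : ∀ k : ℕ, 1 ≤ k → ((k : ℝ) + 1) * c (k + 1) = (k - γ) * c k) {K : ℕ} (hK : 1 ≤ K) :
    (1 - PowerSeries.C γ * PowerSeries.X) * PowerSeries.derivative ℝ
        (∑ k ∈ Finset.range (K + 1), PowerSeries.C (c k) * stableSeries γ ^ k) =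
      1 - PowerSeries.C γ * (∑ k ∈ Finset.range (K + 1), PowerSeries.C (c k) * stableSeries γ ^ k)
        + PowerSeries.C ((γ - K) * c K) * stableSeries γ ^ K := by
  have hG := derivative_stableSeries γ
  induction K, hK using Nat.le_induction with
  | base =>
    simp only [Finset.sum_range_succ, Finset.sum_range_zero, hc0, hc1, map_zero, map_one, zero_mul,
      zero_add, one_mul, pow_one, mul_one, Nat.cast_one, hG, map_sub]
    ring
  | succ K hK ih =>
    rw [Finset.sum_range_succ, map_add, mul_add, ih]
    have hd : PowerSeries.derivative ℝ (PowerSeries.C (c (K + 1)) * stableSeries γ ^ (K + 1)) =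
        PowerSeries.C (((K : ℝ) + 1) * c (K + 1)) * stableSeries γ ^ K *
          PowerSeries.derivative ℝ (stableSeries γ) := by
      rw [Derivation.leibniz, Derivation.leibniz_pow, PowerSeries.derivative_C]
      simp
      ring
    have hd' : (1 - PowerSeries.C γ * PowerSeries.X) *
        PowerSeries.derivative ℝ (PowerSeries.C (c (K + 1)) * stableSeries γ ^ (K + 1)) =
        PowerSeries.C (((K : ℝ) + 1) * c (K + 1)) * stableSeries γ ^ K *
          (1 - stableSeries γ) := by
      rw [hd, ← hG]
      ring
    have hcC : PowerSeries.C (((K : ℝ) + 1) * c (K + 1)) = PowerSeries.C ((K - γ) * c K) := by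
      rw [hc K hK]
    rw [hd']
    simp only [map_mul, map_sub, map_add, map_one, Nat.cast_add, Nat.cast_one] at hcC ⊢
    linear_combination stableSeries γ ^ K * hcC

lemma coeff_sum_stableSeries_pow {c : ℕ → ℝ} (hc0 : c 0 = 0) (hc1 : c 1 = 1)
    (hc : ∀ k : ℕ, 1 ≤ k → ((k : ℝ) + 1) * c (k + 1) = (k - γ) * c k) {K n : ℕ} (hn : 2 ≤ n)
    (hnK : n ≤ K) : PowerSeries.coeff n
      (∑ k ∈ Finset.range (K + 1), PowerSeries.C (c k) * stableSeries γ ^ k) = 0 := by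
  have h := derivative_sum_stableSeries_pow γ hc0 hc1 hc (K := K) (by omega)
  set Y := ∑ k ∈ Finset.range (K + 1), PowerSeries.C (c k) * stableSeries γ ^ k
  have hX : PowerSeries.X ^ K ∣ stableSeries γ ^ K :=
    pow_dvd_pow_of_dvd (PowerSeries.X_dvd_iff.2 (by simpa using coeff_zero_stableSeries γ)) K
  have hrec : ∀ m, 1 ≤ m → m < K → ((m : ℝ) + 1) * PowerSeries.coeff (m + 1) Y =
      γ * (m - 1) * PowerSeries.coeff m Y := by
    intro m hm hmK
    have hm' := congrArg (PowerSeries.coeff m) h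
    rw [coeff_one_sub_X_mul_derivative, map_add, map_sub, PowerSeries.coeff_C_mul,
      PowerSeries.coeff_C_mul, PowerSeries.X_pow_dvd_iff.1 hX m hmK, PowerSeries.coeff_one,
      if_neg (by omega)] at hm'
    linear_combination hm'
  induction n, hn using Nat.le_induction with
  | base =>
    have := hrec 1 le_rfl (by omega)
    norm_num at this
    exact this
  | succ n hn ih =>
    have := hrec n (by omega) (by omega)
    rw [ih (by omega), mul_zero] at this
    exact (mul_eq_zero.1 this).resolve_left (by positivity)

variable {γ}

lemma succ_mul_stableWeight (h2 : γ ≤ 2) {k : ℕ} (hk : 2 ≤ k) :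
    ((k : ℝ) + 1) * stableWeight γ (k + 1) = (k - γ) * stableWeight γ k := by
  have hk' : (2 : ℝ) ≤ k := by exact_mod_cast hk
  rw [stableWeight, stableWeight, Finset.prod_Ico_succ_top (by omega), abs_mul,
    abs_of_nonpos (by linarith : γ - (k : ℝ) ≤ 0), Nat.factorial_succ]
  have : (k.factorial : ℝ) ≠ 0 := by positivity
  push_cast
  field_simp
  ring

lemma coeff_stableSeries_eq_sum (h1 : 1 < γ) (h2 : γ ≤ 2) {n : ℕ} (hn : 2 ≤ n) :
    PowerSeries.coeff n (stableSeries γ) = ∑ k ∈ Finset.Icc 2 n,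
      stableWeight γ k * PowerSeries.coeff n (stableSeries γ ^ k) := by
  let c : ℕ → ℝ := fun k => if k = 0 then 0 else if k = 1 then 1 else -stableWeight γ k
  have hc : ∀ k : ℕ, 1 ≤ k → ((k : ℝ) + 1) * c (k + 1) = (k - γ) * c k := by
    intro k hk
    rcases hk.eq_or_lt with rfl | hk
    · simp [c, stableWeight, abs_of_pos (sub_pos.2 h1)]
      ring
    · simp only [c, if_neg (by omega : k + 1 ≠ 0), if_neg (by omega : k + 1 ≠ 1),
        if_neg (by omega : k ≠ 0), if_neg (by omega : k ≠ 1)]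
      linear_combination -succ_mul_stableWeight h2 (Nat.succ_le_of_lt hk)
  have h := coeff_sum_stableSeries_pow γ (c := c) (by simp [c]) (by simp [c]) hc hn le_rfl
  rw [map_sum, Finset.range_eq_Ico, Finset.sum_eq_sum_Ico_succ_bot (by omega),
    Finset.sum_eq_sum_Ico_succ_bot (by omega)] at h
  have hsum : ∑ k ∈ Finset.Ico 2 (n + 1), PowerSeries.coeff n
      (PowerSeries.C (c k) * stableSeries γ ^ k) =
      -∑ k ∈ Finset.Icc 2 n, stableWeight γ k * PowerSeries.coeff n (stableSeries γ ^ k) := by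
    rw [← Finset.sum_neg_distrib]
    refine Finset.sum_congr (by ext; simp) fun k hk => ?_
    have := (Finset.mem_Icc.1 hk).1
    rw [PowerSeries.coeff_C_mul]
    simp only [c, if_neg (by omega : k ≠ 0), if_neg (by omega : k ≠ 1), neg_mul]
  rw [hsum] at h
  simp only [c, if_true, map_zero, zero_mul, zero_add, one_ne_zero, if_false, map_one, one_mul,
    pow_one] at h
  linear_combination h

lemma sum_treeWeight_stableWeight (h1 : 1 < γ) (h2 : γ ≤ 2) (n : ℕ) :
    ∑ T ∈ reducedTrees n, treeWeight (stableWeight γ) T =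
      PowerSeries.coeff n (stableSeries γ) :=
  sum_treeWeight_eq_of_recurrence (by simp [stableWeight]) (coeff_zero_stableSeries γ)
    (coeff_one_stableSeries γ) (fun _ hn => coeff_stableSeries_eq_sum h1 h2 hn) n

lemma treeWeight_stableWeight (T : Finset (List ℕ)) : treeWeight (stableWeight γ) T =
    (∏ v ∈ internalVertices T, |∏ i ∈ Finset.Ico 1 (numChildren T v), (γ - (i : ℝ))|) /
      ∏ v ∈ internalVertices T, ((numChildren T v).factorial : ℝ) := by
  rw [← Finset.prod_div_distrib, internalVertices, Finset.prod_filter]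
  refine Finset.prod_congr rfl fun v _ => ?_
  split_ifs with h
  · rfl
  · simp [stableWeight, not_not.1 h]

end Stable

/-- For `ψ(u) = u^γ`, `γ ∈ (1,2]`, and `p ≥ 1`, the weights
`w(T) = (p!/∏_{v∈N_T} k_v!) · (∏_{v∈N_T}|(γ-1)(γ-2)···(γ-k_v+1)|) /
((γ-1)(2γ-1)···((p-1)γ-1))` over the (finite) set `T*_p` of rooted ordered trees with `p`
leaves whose internal vertices all have at least 2 children, sum to `1`. -/
theorem stmt13 (γ : ℝ) (h1 : 1 < γ) (h2 : γ ≤ 2) (p : ℕ) (hp : 1 ≤ p) :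
    ∃ S : Finset (Finset (List ℕ)),
      (∀ T, T ∈ S ↔ (IsRootedOrderedTree T ∧ (leaves T).card = p ∧
        ∀ v ∈ internalVertices T, 2 ≤ numChildren T v)) ∧
      ∑ T ∈ S,
        ((p.factorial : ℝ) / ∏ v ∈ internalVertices T, ((numChildren T v).factorial : ℝ)) *
            (∏ v ∈ internalVertices T,
              |∏ i ∈ Finset.Ico 1 (numChildren T v), (γ - (i : ℝ))|) /
            (∏ j ∈ Finset.Ico 1 p, ((j : ℝ) * γ - 1)) = 1 := by
  refine ⟨reducedTrees p, fun T => ?_, ?_⟩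
  · rw [mem_reducedTrees, IsReducedTree]
    tauto
  · have hD : ∏ j ∈ Finset.Ico 1 p, ((j : ℝ) * γ - 1) ≠ 0 := by
      refine Finset.prod_ne_zero_iff.2 fun j hj => ?_
      have : (1 : ℝ) ≤ j := by exact_mod_cast (Finset.mem_Ico.1 hj).1
      nlinarith
    have hsum := sum_treeWeight_stableWeight h1 h2 p
    rw [coeff_stableSeries γ (by omega)] at hsum
    have hp' : (p.factorial : ℝ) ≠ 0 := by positivity
    calc _ = ∑ T ∈ reducedTrees p, (p.factorial : ℝ) /
          (∏ j ∈ Finset.Ico 1 p, ((j : ℝ) * γ - 1)) * treeWeight (stableWeight γ) T := by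
          refine Finset.sum_congr rfl fun T _ => ?_
          rw [treeWeight_stableWeight]
          ring
      _ = 1 := by
          rw [← Finset.mul_sum, hsum, div_mul_div_cancel₀ hD, div_self hp']
end

section
/- Let E be a measurable space, Δ a σ-finite measure on E, a > 0, and let M be a Poisson point measure on [0,a] × E with intensity ds ⊗ Δ(de). Then for any nonnegative measurable function Φ on ([0,a] × E) × (point measures on [0,a] × E), E[∫ M(ds de) Φ((s,e), M)] = E[∫_0^a ds ∫_E Δ(de) Φ((s,e), M + δ_{(s,e)})]. -/
open MeasureTheory
open scoped ENNReal

/-- `expNeg x = e^{-x}` for `x ∈ [0,∞]`, with `expNeg ∞ = 0`. -/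
noncomputable def expNeg (x : ℝ≥0∞) : ℝ≥0∞ :=
  if x = ⊤ then 0 else ENNReal.ofReal (Real.exp (-x.toReal))

open Filter Topology Measure

@[fun_prop]
theorem measurable_expNeg : Measurable expNeg :=
  Measurable.ite (measurableSet_singleton ⊤) measurable_const (by fun_prop)

@[simp] theorem expNeg_zero : expNeg 0 = 1 := by simp [expNeg]

@[simp] theorem expNeg_top : expNeg ⊤ = 0 := by simp [expNeg]

theorem expNeg_of_ne_top {x : ℝ≥0∞} (hx : x ≠ ⊤) :
    expNeg x = ENNReal.ofReal (Real.exp (-x.toReal)) := by simp [expNeg, hx]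

theorem expNeg_le_one (x : ℝ≥0∞) : expNeg x ≤ 1 := by
  unfold expNeg
  split_ifs <;> simp

theorem expNeg_ne_top (x : ℝ≥0∞) : expNeg x ≠ ⊤ :=
  ne_top_of_le_ne_top ENNReal.one_ne_top (expNeg_le_one x)

theorem lintegral_expNeg_ne_top {α : Type*} [MeasurableSpace α] (ν : Measure α)
    [IsFiniteMeasure ν] (g : α → ℝ≥0∞) : ∫⁻ x, expNeg (g x) ∂ν ≠ ⊤ :=
  ne_top_of_le_ne_top (measure_ne_top ν Set.univ)
    ((lintegral_mono fun _ ↦ expNeg_le_one _).trans (by simp))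

theorem expNeg_add (x y : ℝ≥0∞) : expNeg (x + y) = expNeg x * expNeg y := by
  by_cases hx : x = ⊤
  · simp [hx]
  by_cases hy : y = ⊤
  · simp [hy]
  rw [expNeg_of_ne_top hx, expNeg_of_ne_top hy, expNeg_of_ne_top (by simp [hx, hy]),
    ← ENNReal.ofReal_mul (Real.exp_nonneg _), ← Real.exp_add, ENNReal.toReal_add hx hy, neg_add]

theorem one_sub_expNeg_of_ne_top {x : ℝ≥0∞} (hx : x ≠ ⊤) :
    1 - expNeg x = ENNReal.ofReal (1 - Real.exp (-x.toReal)) := by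
  rw [expNeg_of_ne_top hx, ENNReal.ofReal_sub _ (Real.exp_nonneg _), ENNReal.ofReal_one]

theorem one_sub_expNeg_le (x : ℝ≥0∞) : 1 - expNeg x ≤ x := by
  by_cases hx : x = ⊤
  · simp [hx]
  rw [one_sub_expNeg_of_ne_top hx]
  refine ENNReal.ofReal_le_of_le_toReal ?_
  linarith [Real.add_one_le_exp (-x.toReal)]

theorem HasDerivAt.tendsto_nat_mul_sub {φ : ℝ → ℝ} {d : ℝ} (h : HasDerivAt φ d 0) :
    Tendsto (fun n : ℕ ↦ (n : ℝ) * (φ (n : ℝ)⁻¹ - φ 0)) atTop (𝓝 d) := by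
  have := h.tendsto_slope_zero_right.comp
    (tendsto_inv_atTop_nhdsGT_zero.comp tendsto_natCast_atTop_atTop)
  refine this.congr fun n ↦ ?_
  simp

theorem tendsto_nat_mul_one_sub_expNeg_div (m : ℝ≥0∞) :
    Tendsto (fun n : ℕ ↦ (n : ℝ≥0∞) * (1 - expNeg (m / n))) atTop (𝓝 m) := by
  by_cases hm : m = ⊤
  · subst hm
    refine ENNReal.tendsto_nat_nhds_top.congr fun n ↦ ?_
    rw [ENNReal.top_div_of_ne_top (by simp)]
    simp
  have hd : HasDerivAt (fun t : ℝ ↦ -Real.exp (-(t * m.toReal))) m.toReal 0 := by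
    have := (((hasDerivAt_id (0 : ℝ)).mul_const m.toReal).fun_neg.exp).fun_neg
    simpa using this
  have := ENNReal.tendsto_ofReal hd.tendsto_nat_mul_sub
  rw [ENNReal.ofReal_toReal hm] at this
  refine this.congr' ?_
  filter_upwards [eventually_gt_atTop 0] with n hn
  have hn' : (n : ℝ≥0∞) ≠ 0 := by exact_mod_cast hn.ne'
  rw [one_sub_expNeg_of_ne_top (ENNReal.div_ne_top hm hn'), ENNReal.ofReal_mul (by positivity),
    ENNReal.ofReal_natCast, ENNReal.toReal_div]
  simp [div_eq_inv_mul, sub_eq_neg_add, add_comm]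

theorem tendsto_nat_mul_one_sub_expNeg_mul {c : ℝ≥0∞} (hc : c ≠ ⊤) :
    Tendsto (fun n : ℕ ↦ (n : ℝ≥0∞) * (1 - expNeg ((1 - expNeg (n : ℝ≥0∞)⁻¹) * c)))
      atTop (𝓝 c) := by
  have hd : HasDerivAt (fun t : ℝ ↦ -Real.exp (-((1 - Real.exp (-t)) * c.toReal)))
      c.toReal 0 := by
    have := (((((hasDerivAt_id (0 : ℝ)).fun_neg.exp).const_sub 1).mul_const
      c.toReal).fun_neg.exp).fun_neg
    simpa using this
  have := ENNReal.tendsto_ofReal hd.tendsto_nat_mul_sub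
  rw [ENNReal.ofReal_toReal hc] at this
  refine this.congr' ?_
  filter_upwards [eventually_gt_atTop 0] with n hn
  have hn' : (n : ℝ≥0∞)⁻¹ ≠ ⊤ := by simpa using hn.ne'
  have h1 : 1 - expNeg (n : ℝ≥0∞)⁻¹ ≠ ⊤ := by finiteness
  rw [one_sub_expNeg_of_ne_top (ENNReal.mul_ne_top h1 hc), ENNReal.ofReal_mul (by positivity),
    ENNReal.ofReal_natCast, ENNReal.toReal_mul, one_sub_expNeg_of_ne_top hn',
    ENNReal.toReal_ofReal (by simp)]
  simp [sub_eq_neg_add, add_comm]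

section Laplace

variable {X : Type*} [MeasurableSpace X] {μ : Measure X}
  {Ω : Type*} [MeasurableSpace Ω] {P : Measure Ω} [IsProbabilityMeasure P]
  {M : Ω → Measure X}

theorem lintegral_nat_mul_one_sub_expNeg_mul_expNeg (hM : Measurable M)
    (hP : ∀ f : X → ℝ≥0∞, Measurable f →
      ∫⁻ ω, expNeg (∫⁻ x, f x ∂(M ω)) ∂P = expNeg (∫⁻ x, (1 - expNeg (f x)) ∂μ))
    {A : Set X} (hA : MeasurableSet A) {f : X → ℝ≥0∞} (hf : Measurable f) (n : ℕ) :
    ∫⁻ ω, (n * (1 - expNeg (M ω A / n))) * expNeg (∫⁻ x, f x ∂(M ω)) ∂P =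
      (n * (1 - expNeg ((1 - expNeg (n : ℝ≥0∞)⁻¹) * ∫⁻ x in A, expNeg (f x) ∂μ))) *
        ∫⁻ ω, expNeg (∫⁻ x, f x ∂(M ω)) ∂P := by
  have hMf : Measurable fun ω ↦ expNeg (∫⁻ x, f x ∂(M ω)) :=
    measurable_expNeg.comp ((measurable_lintegral hf).comp hM)
  have hg : Measurable fun x ↦ f x + A.indicator (fun _ ↦ (n : ℝ≥0∞)⁻¹) x :=
    hf.add (measurable_const.indicator hA)
  have h_int (ω : Ω) : ∫⁻ x, (f x + A.indicator (fun _ ↦ (n : ℝ≥0∞)⁻¹) x) ∂(M ω) =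
      ∫⁻ x, f x ∂(M ω) + M ω A / n := by
    rw [lintegral_add_left hf, lintegral_indicator_const hA, mul_comm, div_eq_mul_inv]
  have hpt (x : X) : 1 - expNeg (f x + A.indicator (fun _ ↦ (n : ℝ≥0∞)⁻¹) x) =
      (1 - expNeg (f x)) + (1 - expNeg (n : ℝ≥0∞)⁻¹) * A.indicator (fun x ↦ expNeg (f x)) x := by
    by_cases hx : x ∈ A
    · have := expNeg_le_one (n : ℝ≥0∞)⁻¹
      simp only [hx, Set.indicator_of_mem, expNeg_add]
      rw [ENNReal.sub_mul (by simp [expNeg_ne_top]), one_mul, mul_comm (expNeg (f x)),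
        tsub_add_tsub_cancel (expNeg_le_one _) (mul_le_of_le_one_left' this)]
    · simp [hx]
  have key := hP _ hg
  simp_rw [h_int, hpt] at key
  rw [lintegral_add_left (by fun_prop),
    lintegral_const_mul _ ((measurable_expNeg.fun_comp hf).indicator hA), lintegral_indicator hA,
    expNeg_add, ← hP f hf] at key
  have hfin : ∫⁻ ω, expNeg (∫⁻ x, f x ∂(M ω) + M ω A / n) ∂P ≠ ⊤ :=
    lintegral_expNeg_ne_top _ _
  have hMA : Measurable fun ω ↦ expNeg (M ω A / n) :=
    measurable_expNeg.comp (((measurable_coe hA).comp hM).div_const _)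
  set k := (1 - expNeg (n : ℝ≥0∞)⁻¹) * ∫⁻ x in A, expNeg (f x) ∂μ
  simp_rw [mul_assoc]
  rw [lintegral_const_mul _ (by fun_prop)]
  congr 1
  simp_rw [expNeg_add] at key hfin
  simp_rw [ENNReal.sub_mul fun _ _ ↦ expNeg_ne_top _, one_mul, mul_comm (expNeg (_ / _))]
  rw [lintegral_sub (by fun_prop) hfin
      (ae_of_all _ fun ω ↦ mul_le_of_le_one_right' (expNeg_le_one _)),
    key, ENNReal.sub_mul fun _ _ ↦ lintegral_expNeg_ne_top _ _, one_mul, mul_comm (expNeg k)]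

theorem lintegral_apply_le_of_laplace (hM : Measurable M)
    (hP : ∀ f : X → ℝ≥0∞, Measurable f →
      ∫⁻ ω, expNeg (∫⁻ x, f x ∂(M ω)) ∂P = expNeg (∫⁻ x, (1 - expNeg (f x)) ∂μ))
    {A : Set X} (hA : MeasurableSet A) (hμA : μ A ≠ ⊤) :
    ∫⁻ ω, M ω A ∂P ≤ μ A := by
  have hMA (n : ℕ) : Measurable fun ω ↦ (n : ℝ≥0∞) * (1 - expNeg (M ω A / n)) := by
    have := (measurable_coe hA).fun_comp hM
    fun_prop
  have h (n : ℕ) := lintegral_nat_mul_one_sub_expNeg_mul_expNeg hM hP hA (measurable_zero) n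
  simp only [Pi.zero_apply, lintegral_zero, expNeg_zero, mul_one, lintegral_const, measure_univ,
    one_mul, Measure.restrict_apply_univ] at h
  calc ∫⁻ ω, M ω A ∂P
      = ∫⁻ ω, liminf (fun n : ℕ ↦ (n : ℝ≥0∞) * (1 - expNeg (M ω A / n))) atTop ∂P :=
        lintegral_congr fun ω ↦ (tendsto_nat_mul_one_sub_expNeg_div _).liminf_eq.symm
    _ ≤ liminf (fun n : ℕ ↦ ∫⁻ ω, (n : ℝ≥0∞) * (1 - expNeg (M ω A / n)) ∂P) atTop :=
        lintegral_liminf_le hMA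
    _ = μ A := by
        simp_rw [h]
        exact (tendsto_nat_mul_one_sub_expNeg_mul hμA).liminf_eq

theorem lintegral_apply_mul_expNeg_of_laplace (hM : Measurable M)
    (hP : ∀ f : X → ℝ≥0∞, Measurable f →
      ∫⁻ ω, expNeg (∫⁻ x, f x ∂(M ω)) ∂P = expNeg (∫⁻ x, (1 - expNeg (f x)) ∂μ))
    {A : Set X} (hA : MeasurableSet A) (hμA : μ A ≠ ⊤) {f : X → ℝ≥0∞} (hf : Measurable f) :
    ∫⁻ ω, M ω A * expNeg (∫⁻ x, f x ∂(M ω)) ∂P =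
      ∫⁻ ω, ∫⁻ x in A, expNeg (∫⁻ y, f y ∂(M ω + dirac x)) ∂μ ∂P := by
  have hMf : Measurable fun ω ↦ expNeg (∫⁻ x, f x ∂(M ω)) :=
    measurable_expNeg.comp ((measurable_lintegral hf).comp hM)
  have hMA (n : ℕ) : Measurable fun ω ↦ expNeg (M ω A / n) :=
    measurable_expNeg.comp (((measurable_coe hA).comp hM).div_const _)
  have hc : ∫⁻ x in A, expNeg (f x) ∂μ ≠ ⊤ :=
    ne_top_of_le_ne_top hμA ((lintegral_mono fun _ ↦ expNeg_le_one _).trans (by simp))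
  have hlim := tendsto_lintegral_of_dominated_convergence (μ := P) (fun ω ↦ M ω A)
    (F := fun n ω ↦ (n * (1 - expNeg (M ω A / n))) * expNeg (∫⁻ x, f x ∂(M ω)))
    (f := fun ω ↦ M ω A * expNeg (∫⁻ x, f x ∂(M ω)))
    (fun n ↦ by have := hMA n; fun_prop)
    (fun n ↦ ae_of_all _ fun ω ↦ (mul_le_of_le_one_right' (expNeg_le_one _)).trans
      ((mul_le_mul_right (one_sub_expNeg_le _) _).trans ENNReal.mul_div_le))
    (ne_top_of_le_ne_top hμA (lintegral_apply_le_of_laplace hM hP hA hμA))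
    (ae_of_all _ fun ω ↦ ENNReal.Tendsto.mul_const (tendsto_nat_mul_one_sub_expNeg_div _)
      (.inr (expNeg_ne_top _)))
  simp_rw [lintegral_nat_mul_one_sub_expNeg_mul_expNeg hM hP hA hf] at hlim
  refine (tendsto_nhds_unique hlim (ENNReal.Tendsto.mul_const
    (tendsto_nat_mul_one_sub_expNeg_mul hc) (.inr ?_))).trans ?_
  · exact lintegral_expNeg_ne_top _ _
  · rw [← lintegral_const_mul _ hMf]
    refine lintegral_congr fun ω ↦ ?_
    rw [mul_comm, ← lintegral_const_mul _ (measurable_expNeg.fun_comp hf)]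
    simp_rw [lintegral_add_measure, lintegral_dirac' _ hf, expNeg_add]

end Laplace

theorem ext_of_forall_submonoid_integral_eq_pi {ι : Type*} [Fintype ι]
    {ν₁ ν₂ : Measure (ι → unitInterval)} [IsFiniteMeasure ν₁] [IsFiniteMeasure ν₂]
    (T : Submonoid ((ι → unitInterval) → ℝ))
    (hT : ∀ i, (fun z : ι → unitInterval ↦ (z i : ℝ)) ∈ T)
    (h : ∀ g ∈ T, ∫ z, g z ∂ν₁ = ∫ z, g z ∂ν₂) : ν₁ = ν₂ := by
  let p (i : ι) : BoundedContinuousFunction (ι → unitInterval) ℝ :=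
    .mkOfCompact ⟨fun z ↦ (z i : ℝ), by fun_prop⟩
  let A : StarSubalgebra ℝ (BoundedContinuousFunction (ι → unitInterval) ℝ) :=
    { Algebra.adjoin ℝ (Set.range p) with
      star_mem' := fun {g} hg ↦ by
        have : star g = g := by ext; simp
        rwa [this] }
  refine ext_of_forall_mem_subalgebra_integral_eq_of_polish (A := A) ?_ fun g hg ↦ ?_
  · intro z w hzw
    obtain ⟨i, hi⟩ := Function.ne_iff.1 hzw
    refine ⟨p i, ⟨(p i).toContinuousMapStarₐ ℝ, ⟨p i, ?_, rfl⟩, rfl⟩, ?_⟩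
    · exact Algebra.subset_adjoin ⟨i, rfl⟩
    · exact fun h ↦ hi (Subtype.ext h)
  · have hg' : g ∈ Subalgebra.toSubmodule (Algebra.adjoin ℝ (Set.range p)) := hg
    rw [Algebra.adjoin_eq_span] at hg'
    clear hg
    induction hg' using Submodule.span_induction with
    | mem g hgc =>
      refine h _ ?_
      induction hgc using Submonoid.closure_induction with
      | mem g hg =>
        obtain ⟨i, rfl⟩ := hg
        exact hT i
      | one => exact one_mem T
      | mul f g _ _ hf hg => exact mul_mem hf hg
    | zero => simp
    | add f g _ _ hf hg =>
      simp only [BoundedContinuousFunction.coe_add, Pi.add_apply]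
      rw [integral_add (f.integrable _) (g.integrable _),
        integral_add (f.integrable _) (g.integrable _), hf, hg]
    | smul c g _ hg =>
      simp only [BoundedContinuousFunction.coe_smul]
      rw [integral_smul, integral_smul, hg]

theorem ext_of_forall_submonoid_integral_eq {Y : Type*} [m : MeasurableSpace Y]
    {ν₁ ν₂ : Measure Y} [IsFiniteMeasure ν₁] [IsFiniteMeasure ν₂]
    (S : Submonoid (Y → unitInterval)) (hS : ∀ g ∈ S, Measurable g)
    (hm : m ≤ ⨆ g : S, MeasurableSpace.comap (g : Y → unitInterval) inferInstance)
    (h : ∀ g ∈ S, ∫ y, (g y : ℝ) ∂ν₁ = ∫ y, (g y : ℝ) ∂ν₂) : ν₁ = ν₂ := by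
  let G : Y → S → unitInterval := fun y g ↦ (g : Y → unitInterval) y
  have hG : Measurable G := measurable_pi_lambda _ fun g ↦ hS g g.2
  have hmap : ν₁.map G = ν₂.map G := by
    refine IsProjectiveLimit.unique (P := fun J ↦ (ν₂.map G).map J.restrict)
      (fun J ↦ ?_) fun J ↦ rfl
    have hJ : Measurable (J.restrict ∘ G) := (Finset.measurable_restrict J).comp hG
    change (ν₁.map G).map J.restrict = (ν₂.map G).map J.restrict
    rw [Measure.map_map (Finset.measurable_restrict J) hG,
      Measure.map_map (Finset.measurable_restrict J) hG]
    let T : Submonoid ((J → unitInterval) → ℝ) :=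
      { carrier := {f | Measurable f ∧ ∃ g ∈ S, ∀ y, f (J.restrict (G y)) = g y}
        one_mem' := ⟨measurable_const, 1, one_mem S, fun y ↦ by simp⟩
        mul_mem' := by
          rintro f f' ⟨hf, g, hg, hfg⟩ ⟨hf', g', hg', hfg'⟩
          exact ⟨hf.mul hf', g * g', mul_mem hg hg', fun y ↦ by simp [hfg, hfg']⟩ }
    refine ext_of_forall_submonoid_integral_eq_pi T (fun i ↦ ?_) ?_
    · exact ⟨by fun_prop, i.1, i.1.2, fun y ↦ rfl⟩
    · rintro f ⟨hf, g, hg, hfg⟩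
      rw [integral_map hJ.aemeasurable hf.aestronglyMeasurable,
        integral_map hJ.aemeasurable hf.aestronglyMeasurable]
      simpa [hfg] using h g hg
  ext s hs
  have hs' : MeasurableSet[MeasurableSpace.comap G inferInstance] s := by
    refine hm.trans (iSup_le fun g ↦ ?_) s hs
    rw [← measurable_iff_comap_le]
    exact (measurable_pi_apply g).comp (comap_measurable G)
  obtain ⟨t, ht, rfl⟩ := hs'
  rw [← Measure.map_apply hG ht, hmap, Measure.map_apply hG ht]

theorem Measurable.measure_map_prodMk {α β γ : Type*} [MeasurableSpace α] [MeasurableSpace β]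
    [MeasurableSpace γ] {N : α → Measure β} [∀ a, IsFiniteMeasure (N a)] (hN : Measurable N)
    {g : α → γ} (hg : Measurable g) :
    Measurable fun a ↦ (N a).map fun b ↦ (b, g a) := by
  have hmk (a : α) : Measurable fun b : β ↦ (b, g a) := by fun_prop
  refine Measurable.measure_of_isPiSystem generateFrom_prod.symm isPiSystem_prod ?_ ?_
  · rintro _ ⟨s, hs, t, ht, rfl⟩
    have : (fun a ↦ (N a).map (fun b ↦ (b, g a)) (s ×ˢ t)) =
        (g ⁻¹' t).indicator fun a ↦ N a s := by
      ext a
      rw [Measure.map_apply (hmk a) (hs.prod ht)]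
      by_cases ha : g a ∈ t <;> simp [ha]
    rw [this]
    exact ((measurable_coe hs).comp hN).indicator (hg ht)
  · simp_rw [Measure.map_apply (hmk _) MeasurableSet.univ, Set.preimage_univ]
    exact (measurable_coe MeasurableSet.univ).comp hN

section Palm

variable {X : Type*} [MeasurableSpace X]

/-- The test function `(x, m) ↦ 1_A(x) e^{-m(f)}`. -/
noncomputable def laplaceTest (A : Set X) (f : X → ℝ≥0∞) (y : X × Measure X) : ℝ≥0∞ :=
  A.indicator 1 y.1 * expNeg (∫⁻ x, f x ∂y.2)

theorem laplaceTest_le_one (A : Set X) (f : X → ℝ≥0∞) (y : X × Measure X) :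
    laplaceTest A f y ≤ 1 :=
  mul_le_one' (Set.indicator_le_self' (by simp) y.1) (expNeg_le_one _)

theorem measurable_laplaceTest {A : Set X} (hA : MeasurableSet A) {f : X → ℝ≥0∞}
    (hf : Measurable f) : Measurable (laplaceTest A f) := by
  have h1 : Measurable fun y : X × Measure X ↦ ∫⁻ x, f x ∂y.2 :=
    (measurable_lintegral hf).comp measurable_snd
  exact ((measurable_const.indicator hA).comp measurable_fst).mul (measurable_expNeg.comp h1)

/-- The multiplicative class of test functions `laplaceTest A f`, as functions to `[0,1]`. -/
def laplaceTestSubmonoid (X : Type*) [MeasurableSpace X] :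
    Submonoid (X × Measure X → unitInterval) where
  carrier := {g | ∃ A : Set X, MeasurableSet A ∧ ∃ f : X → ℝ≥0∞, Measurable f ∧
    ∀ y, (g y : ℝ) = (laplaceTest A f y).toReal}
  one_mem' := ⟨Set.univ, .univ, 0, measurable_zero, fun y ↦ by simp [laplaceTest]⟩
  mul_mem' := by
    rintro g g' ⟨A, hA, f, hf, hg⟩ ⟨A', hA', f', hf', hg'⟩
    refine ⟨A ∩ A', hA.inter hA', f + f', hf.add hf', fun y ↦ ?_⟩
    simp only [Pi.mul_apply, Set.Icc.coe_mul, hg, hg', ← ENNReal.toReal_mul, laplaceTest,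
      Set.inter_indicator_one, Pi.add_apply, lintegral_add_left hf, expNeg_add]
    congr 1
    ring

theorem exists_mem_laplaceTestSubmonoid {A : Set X} (hA : MeasurableSet A) {f : X → ℝ≥0∞}
    (hf : Measurable f) :
    ∃ g ∈ laplaceTestSubmonoid X, ∀ y, (g y : ℝ) = (laplaceTest A f y).toReal :=
  ⟨fun y ↦ ⟨(laplaceTest A f y).toReal, ENNReal.toReal_nonneg,
    ENNReal.toReal_le_of_le_ofReal zero_le_one (by simpa using laplaceTest_le_one A f y)⟩,
    ⟨A, hA, f, hf, fun _ ↦ rfl⟩, fun _ ↦ rfl⟩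

/-- A left inverse of `expNeg`. -/
noncomputable def negLog (r : ℝ) : ℝ≥0∞ :=
  if r = 0 then ⊤ else ENNReal.ofReal (-Real.log r)

theorem measurable_negLog : Measurable negLog :=
  Measurable.ite (measurableSet_singleton 0) measurable_const (by fun_prop)

theorem negLog_expNeg (x : ℝ≥0∞) : negLog (expNeg x).toReal = x := by
  by_cases hx : x = ⊤
  · simp [hx, negLog]
  rw [expNeg_of_ne_top hx, ENNReal.toReal_ofReal (Real.exp_nonneg _), negLog,
    if_neg (Real.exp_ne_zero _), Real.log_exp, neg_neg, ENNReal.ofReal_toReal hx]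

theorem le_iSup_comap_laplaceTestSubmonoid :
    (inferInstance : MeasurableSpace (X × Measure X)) ≤
      ⨆ g : laplaceTestSubmonoid X,
        MeasurableSpace.comap (g : X × Measure X → unitInterval) inferInstance := by
  set m' := ⨆ g : laplaceTestSubmonoid X,
    MeasurableSpace.comap (g : X × Measure X → unitInterval) inferInstance
  have key {A : Set X} (hA : MeasurableSet A) {f : X → ℝ≥0∞} (hf : Measurable f) :
      Measurable[m'] fun y ↦ (laplaceTest A f y).toReal := by
    obtain ⟨g, hg, hgy⟩ := exists_mem_laplaceTestSubmonoid hA hf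
    simp_rw [← hgy]
    refine measurable_subtype_coe.comp (Measurable.of_comap_le ?_)
    exact le_iSup (fun g : laplaceTestSubmonoid X ↦
      MeasurableSpace.comap (g : X × Measure X → unitInterval) inferInstance) ⟨g, hg⟩
  refine sup_le ?_ ?_
  · rintro _ ⟨A, hA, rfl⟩
    convert key hA measurable_zero (measurableSet_singleton 1) using 1
    ext y
    by_cases hy : y.1 ∈ A <;> simp [laplaceTest, hy]
  · refine Measurable.comap_le (measurable_of_measurable_coe _ fun s hs ↦ ?_)
    have := measurable_negLog.comp (key .univ (measurable_one.indicator hs))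
    convert this using 2 with y
    simp [laplaceTest, lintegral_indicator_one hs, negLog_expNeg]

theorem ext_of_forall_lintegral_laplaceTest_eq {ν₁ ν₂ : Measure (X × Measure X)}
    [IsFiniteMeasure ν₁] [IsFiniteMeasure ν₂]
    (h : ∀ A : Set X, MeasurableSet A → ∀ f : X → ℝ≥0∞, Measurable f →
      ∫⁻ y, laplaceTest A f y ∂ν₁ = ∫⁻ y, laplaceTest A f y ∂ν₂) : ν₁ = ν₂ := by
  refine ext_of_forall_submonoid_integral_eq (laplaceTestSubmonoid X) ?_
    le_iSup_comap_laplaceTestSubmonoid ?_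
  · rintro g ⟨A, hA, f, hf, hg⟩
    refine (MeasurableEmbedding.subtype_coe measurableSet_Icc).measurable_comp_iff.1 ?_
    simpa only [Function.comp_def, hg] using (measurable_laplaceTest hA hf).ennreal_toReal
  · rintro g ⟨A, hA, f, hf, hg⟩
    have hlt (y : X × Measure X) : laplaceTest A f y < ⊤ :=
      (laplaceTest_le_one A f y).trans_lt ENNReal.one_lt_top
    simp_rw [hg]
    rw [integral_toReal (measurable_laplaceTest hA hf).aemeasurable (ae_of_all _ hlt),
      integral_toReal (measurable_laplaceTest hA hf).aemeasurable (ae_of_all _ hlt), h A hA f hf]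

variable {μ : Measure X} {Ω : Type*} [MeasurableSpace Ω] {P : Measure Ω} [IsProbabilityMeasure P]
  {M : Ω → Measure X}

theorem measurable_prodMk_add_dirac (hM : Measurable M) :
    Measurable fun p : Ω × X ↦ (p.2, M p.1 + dirac p.2) :=
  measurable_snd.prodMk ((hM.comp measurable_fst).add (measurable_dirac.comp measurable_snd))

theorem mecke_on_of_laplace (hM : Measurable M)
    (hP : ∀ f : X → ℝ≥0∞, Measurable f →
      ∫⁻ ω, expNeg (∫⁻ x, f x ∂(M ω)) ∂P = expNeg (∫⁻ x, (1 - expNeg (f x)) ∂μ))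
    {B : Set X} (hB : MeasurableSet B) (hμB : μ B ≠ ⊤)
    {Φ : X × Measure X → ℝ≥0∞} (hΦ : Measurable Φ) :
    AEMeasurable (fun ω ↦ ∫⁻ x in B, Φ (x, M ω) ∂(M ω)) P ∧
    ∫⁻ ω, ∫⁻ x in B, Φ (x, M ω) ∂(M ω) ∂P =
      ∫⁻ ω, ∫⁻ x in B, Φ (x, M ω + dirac x) ∂μ ∂P := by
  classical
  have hMB : Measurable fun ω ↦ M ω B := (measurable_coe hB).comp hM
  have hle := lintegral_apply_le_of_laplace hM hP hB hμB
  have : IsFiniteMeasure (μ.restrict B) := ⟨by simpa using hμB.lt_top⟩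
  let N (ω : Ω) : Measure X := if M ω B < ⊤ then (M ω).restrict B else 0
  have hN_eq : ∀ᵐ ω ∂P, N ω = (M ω).restrict B := by
    filter_upwards [ae_lt_top hMB (ne_top_of_le_ne_top hμB hle)] with ω hω
    exact if_pos hω
  have hN_fin (ω : Ω) : IsFiniteMeasure (N ω) := by
    by_cases hω : M ω B < ⊤
    · simp only [N, hω, if_true]
      exact ⟨by simpa using hω⟩
    · simp only [N, hω, if_false]
      infer_instance
  have hN : Measurable N :=
    Measurable.ite (measurableSet_lt hMB measurable_const)
      (measurable_of_measurable_coe _ fun s hs ↦ by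
        simpa only [Measure.restrict_apply hs] using (measurable_coe (hs.inter hB)).fun_comp hM)
      measurable_const
  let κ (ω : Ω) : Measure (X × Measure X) := (N ω).map fun x ↦ (x, M ω)
  have hκ : Measurable κ := hN.measure_map_prodMk hM
  have hκ_eq {F : X × Measure X → ℝ≥0∞} (hF : Measurable F) :
      (fun ω ↦ ∫⁻ y, F y ∂(κ ω)) =ᵐ[P] fun ω ↦ ∫⁻ x in B, F (x, M ω) ∂(M ω) := by
    filter_upwards [hN_eq] with ω hω
    rw [lintegral_map hF (by fun_prop), hω]
  have h1 {F : X × Measure X → ℝ≥0∞} (hF : Measurable F) :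
      ∫⁻ y, F y ∂(P.bind κ) = ∫⁻ ω, ∫⁻ x in B, F (x, M ω) ∂(M ω) ∂P := by
    rw [lintegral_bind hκ.aemeasurable hF.aemeasurable, lintegral_congr_ae (hκ_eq hF)]
  have h2 {F : X × Measure X → ℝ≥0∞} (hF : Measurable F) :
      ∫⁻ y, F y ∂((P.prod (μ.restrict B)).map fun p ↦ (p.2, M p.1 + dirac p.2)) =
        ∫⁻ ω, ∫⁻ x in B, F (x, M ω + dirac x) ∂μ ∂P := by
    have hF' := hF.comp (measurable_prodMk_add_dirac hM)
    rw [lintegral_map hF (measurable_prodMk_add_dirac hM)]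
    exact lintegral_prod _ hF'.aemeasurable
  have : IsFiniteMeasure (P.bind κ) := by
    refine ⟨?_⟩
    rw [← lintegral_one, h1 measurable_const]
    simpa using hle.trans_lt hμB.lt_top
  refine ⟨AEMeasurable.congr ((measurable_lintegral hΦ).comp hκ).aemeasurable (hκ_eq hΦ), ?_⟩
  rw [← h1 hΦ, ← h2 hΦ]
  congr 1
  refine ext_of_forall_lintegral_laplaceTest_eq fun A hA f hf ↦ ?_
  have hind (m : Measure X) (F : X → ℝ≥0∞) :
      ∫⁻ x in B, A.indicator 1 x * F x ∂m = ∫⁻ x in A ∩ B, F x ∂m := by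
    rw [← Measure.restrict_restrict hA, ← lintegral_indicator hA]
    refine lintegral_congr fun x ↦ ?_
    by_cases hx : x ∈ A <;> simp [hx]
  rw [h1 (measurable_laplaceTest hA hf), h2 (measurable_laplaceTest hA hf)]
  simp_rw [laplaceTest, hind]
  rw [← lintegral_apply_mul_expNeg_of_laplace hM hP (hA.inter hB)
    (ne_top_of_le_ne_top hμB (measure_mono Set.inter_subset_right)) hf]
  simp [mul_comm]

theorem mecke_of_laplace [SigmaFinite μ] (hM : Measurable M)
    (hP : ∀ f : X → ℝ≥0∞, Measurable f →
      ∫⁻ ω, expNeg (∫⁻ x, f x ∂(M ω)) ∂P = expNeg (∫⁻ x, (1 - expNeg (f x)) ∂μ))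
    {Φ : X × Measure X → ℝ≥0∞} (hΦ : Measurable Φ) :
    ∫⁻ ω, ∫⁻ x, Φ (x, M ω) ∂(M ω) ∂P = ∫⁻ ω, ∫⁻ x, Φ (x, M ω + dirac x) ∂μ ∂P := by
  let B (n : ℕ) : Set X := disjointed (spanningSets μ) n
  have hB (n : ℕ) : MeasurableSet (B n) := .disjointed (measurableSet_spanningSets μ) n
  have hμB (n : ℕ) : μ (B n) ≠ ⊤ :=
    ((measure_mono (disjointed_subset _ _)).trans_lt (measure_spanningSets_lt_top μ n)).ne
  have hsum (m : Measure X) (F : X → ℝ≥0∞) : ∫⁻ x, F x ∂m = ∑' n, ∫⁻ x in B n, F x ∂m := by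
    conv_lhs => rw [← sum_restrict_disjointed_spanningSets m μ, lintegral_sum_measure]
  have hmeas (n : ℕ) : AEMeasurable (fun ω ↦ ∫⁻ x in B n, Φ (x, M ω + dirac x) ∂μ) P :=
    (hΦ.comp (measurable_prodMk_add_dirac hM)).lintegral_prod_right'.aemeasurable
  rw [lintegral_congr fun ω ↦ hsum (M ω) fun x ↦ Φ (x, M ω),
    lintegral_congr fun ω ↦ hsum μ fun x ↦ Φ (x, M ω + dirac x)]
  rw [lintegral_tsum fun n ↦ (mecke_on_of_laplace hM hP (hB n) (hμB n) hΦ).1, lintegral_tsum hmeas]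
  exact tsum_congr fun n ↦ (mecke_on_of_laplace hM hP (hB n) (hμB n) hΦ).2

end Palm

/-- Palm/Mecke formula: Let `Δ` be a σ-finite measure on `E`, `a > 0`, and
let `M` be a Poisson point measure on `[0,a] × E` with intensity `ds ⊗ Δ(de)`
(characterized by its Laplace functional). Then for any nonnegative measurable `Φ`,
`E[∫ M(ds de) Φ((s,e), M)] = E[∫_0^a ds ∫ Δ(de) Φ((s,e), M + δ_{(s,e)})]`. -/
theorem stmt17 {E : Type*} [MeasurableSpace E] (Δ : Measure E) [SigmaFinite Δ]
    (a : ℝ) (ha : 0 < a)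
    {Ω : Type*} [MeasurableSpace Ω] (P : Measure Ω) [IsProbabilityMeasure P]
    (M : Ω → Measure (ℝ × E)) (hM : Measurable M)
    (hPoisson : ∀ f : ℝ × E → ℝ≥0∞, Measurable f →
      ∫⁻ ω, expNeg (∫⁻ x, f x ∂(M ω)) ∂P =
        expNeg (∫⁻ x, (1 - expNeg (f x)) ∂((volume.restrict (Set.Icc 0 a)).prod Δ)))
    (Φ : (ℝ × E) × Measure (ℝ × E) → ℝ≥0∞) (hΦ : Measurable Φ) :
    ∫⁻ ω, (∫⁻ x, Φ (x, M ω) ∂(M ω)) ∂P =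
      ∫⁻ ω, (∫⁻ x, Φ (x, M ω + Measure.dirac x)
        ∂((volume.restrict (Set.Icc 0 a)).prod Δ)) ∂P := by
  exact mecke_of_laplace hM hPoisson hΦ
end
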